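/- arXiv:2507.14480 — 2 statements merged into one kernel-verified Lean document; each statement's English description precedes it below -/
import Mathlib

section
/- Let k_m, h₋, h, h₊, h' ∈ ℂ with k_m ≠ 0, h ≠ 0, h' ≠ 0 and h₋ − h₊ = 2h', and let β ∈ ℝ. Define the 3×3 complex matrices Q with rows ( h₊/(2i), −h₋/(2i), 0 ), ( 0, 0, −h ), ( k_m·h/2, −k_m·h/2, −β·h ), and Q' with rows ( −i/h', −β·h₋/(k_m·h·h'), h₋/(k_m·h·h') ), ( −i/h', −β·h₊/(k_m·h·h'), h₊/(k_m·h·h') ), ( 0, −1/h, 0 ). Then Q·Q' = I and Q'·Q = I, i.e. Q is invertible with Q^{−1} = Q'. -/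
open Complex Matrix

/-- Explicit inverse of the matrix `Q_{nm}` of Lemma 3.1
(`hm, h, hp, h'` stand for `H⁽¹⁾_{n−1}(k_m R), H⁽¹⁾_n(k_m R), H⁽¹⁾_{n+1}(k_m R), H⁽¹⁾′_n(k_m R)`):
under `k_m ≠ 0`, `h ≠ 0`, `h' ≠ 0` and the recurrence `hm − hp = 2h'`, one has
`Q·Q' = 1` and `Q'·Q = 1`, i.e. `Q` is invertible with inverse `Q'`. -/
theorem Q_matrix_inverse (k_m hm h hp h' : ℂ) (β : ℝ)
    (hkm : k_m ≠ 0) (hh : h ≠ 0) (hh' : h' ≠ 0) (hrec : hm - hp = 2 * h') :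
    (!![hp / (2 * Complex.I), -hm / (2 * Complex.I), 0;
        0, 0, -h;
        k_m * h / 2, -(k_m * h / 2), -(β : ℂ) * h] *
     !![-Complex.I / h', -(β : ℂ) * hm / (k_m * h * h'), hm / (k_m * h * h');
        -Complex.I / h', -(β : ℂ) * hp / (k_m * h * h'), hp / (k_m * h * h');
        0, -1 / h, 0] = 1)
    ∧ (!![-Complex.I / h', -(β : ℂ) * hm / (k_m * h * h'), hm / (k_m * h * h');
          -Complex.I / h', -(β : ℂ) * hp / (k_m * h * h'), hp / (k_m * h * h');
          0, -1 / h, 0] *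
       !![hp / (2 * Complex.I), -hm / (2 * Complex.I), 0;
          0, 0, -h;
          k_m * h / 2, -(k_m * h / 2), -(β : ℂ) * h] = 1) := by
  obtain rfl : hm = hp + 2 * h' := by linear_combination hrec
  refine (and_iff_left_of_imp mul_eq_one_comm.mp).mpr ?_
  ext i j
  fin_cases i <;> fin_cases j <;>
    simp [Matrix.mul_apply, Fin.sum_univ_three] <;> field_simp <;> ring
end

section
/- Let k_m, k, c ∈ ℝ with k_m ≠ 0, and let w ∈ ℂ with w ≠ 0 and Im w ≤ 0. Define the 2×2 complex matrix W̃ with rows ( k_m²·w, i·c·w ) and ( −i·c·w, (c²/k_m²)·w − k²/(k_m²·w) ). Then for every z = (z₁, z₂) ∈ ℂ², Im( conj(z₁)·(W̃₁₁z₁ + W̃₁₂z₂) + conj(z₂)·(W̃₂₁z₁ + W̃₂₂z₂) ) ≤ 0. Moreover, if Im w < 0, k ≠ 0 and z ≠ 0, then this imaginary part is strictly negative. -/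
open Complex

/-- The imaginary part of the quadratic form of the symbol is `Im w` times a sum of squares,
obtained by completing the square in `z₁`. -/
lemma calderon_form_im (k_m k c : ℝ) (hkm : k_m ≠ 0) (w z₁ z₂ : ℂ) :
    ((starRingEnd ℂ) z₁ * (((k_m : ℂ) ^ 2 * w) * z₁ + (Complex.I * (c : ℂ) * w) * z₂)
      + (starRingEnd ℂ) z₂ * ((-(Complex.I * (c : ℂ) * w)) * z₁
          + (((c : ℂ) ^ 2 / (k_m : ℂ) ^ 2) * w - (k : ℂ) ^ 2 / ((k_m : ℂ) ^ 2 * w)) * z₂)).im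
      = w.im * (normSq (k_m * z₁ + I * (c / k_m : ℝ) * z₂)
          + k ^ 2 / k_m ^ 2 * normSq z₂ / normSq w) := by
  have hkm' : (k_m : ℂ) ≠ 0 := ofReal_ne_zero.mpr hkm
  have square_completed :
      (starRingEnd ℂ) z₁ * (((k_m : ℂ) ^ 2 * w) * z₁ + (Complex.I * (c : ℂ) * w) * z₂)
        + (starRingEnd ℂ) z₂ * ((-(Complex.I * (c : ℂ) * w)) * z₁
            + (((c : ℂ) ^ 2 / (k_m : ℂ) ^ 2) * w - (k : ℂ) ^ 2 / ((k_m : ℂ) ^ 2 * w)) * z₂)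
      = (normSq (k_m * z₁ + I * (c / k_m : ℝ) * z₂) : ℝ) * w
          - (k ^ 2 / k_m ^ 2 * normSq z₂ : ℝ) * w⁻¹ := by
    push_cast
    simp only [normSq_eq_conj_mul_self, map_add, map_mul, map_div₀, conj_ofReal, conj_I]
    rw [← div_div, div_eq_mul_inv _ w]
    generalize w⁻¹ = v
    field_simp
    linear_combination ((starRingEnd ℂ) z₂ * c ^ 2 * z₂ * w) * I_sq
  rw [square_completed, sub_im, im_ofReal_mul, im_ofReal_mul, inv_im]
  ring

/-- Modal form of Lemma 3.4: for the sign-adjusted Calderón symbol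
`W̃ = [[k_m² w, i c w], [−i c w, (c²/k_m²)w − k²/(k_m² w)]]` with `Im w ≤ 0`,
the quadratic form `Im(conj z · W̃ z)` is nonpositive, and strictly negative
when `Im w < 0`, `k ≠ 0` and `z ≠ 0`. -/
theorem calderon_symbol_im_nonpos (k_m k c : ℝ) (hkm : k_m ≠ 0)
    (w : ℂ) (hw : w ≠ 0) (hiw : w.im ≤ 0) :
    (∀ z₁ z₂ : ℂ,
      ((starRingEnd ℂ) z₁ * (((k_m : ℂ) ^ 2 * w) * z₁ + (Complex.I * (c : ℂ) * w) * z₂)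
        + (starRingEnd ℂ) z₂ * ((-(Complex.I * (c : ℂ) * w)) * z₁
            + (((c : ℂ) ^ 2 / (k_m : ℂ) ^ 2) * w - (k : ℂ) ^ 2 / ((k_m : ℂ) ^ 2 * w)) * z₂)).im
        ≤ 0)
    ∧ (w.im < 0 → k ≠ 0 → ∀ z₁ z₂ : ℂ, ¬(z₁ = 0 ∧ z₂ = 0) →
      ((starRingEnd ℂ) z₁ * (((k_m : ℂ) ^ 2 * w) * z₁ + (Complex.I * (c : ℂ) * w) * z₂)
        + (starRingEnd ℂ) z₂ * ((-(Complex.I * (c : ℂ) * w)) * z₁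
            + (((c : ℂ) ^ 2 / (k_m : ℂ) ^ 2) * w - (k : ℂ) ^ 2 / ((k_m : ℂ) ^ 2 * w)) * z₂)).im
        < 0) := by
  refine ⟨fun z₁ z₂ => ?_, fun him hk z₁ z₂ hz => ?_⟩
  · rw [calderon_form_im k_m k c hkm]
    have h₁ := normSq_nonneg (k_m * z₁ + I * (c / k_m : ℝ) * z₂)
    have h₂ := normSq_nonneg z₂
    have h₃ := normSq_nonneg w
    exact mul_nonpos_of_nonpos_of_nonneg hiw (by positivity)
  · rw [calderon_form_im k_m k c hkm]
    have h₁ := normSq_nonneg (k_m * z₁ + I * (c / k_m : ℝ) * z₂)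
    have h₃ := normSq_pos.mpr hw
    refine mul_neg_of_neg_of_pos him ?_
    by_cases hz₂ : z₂ = 0
    · have hz₁ : z₁ ≠ 0 := fun h => hz ⟨h, hz₂⟩
      have := normSq_pos.mpr (mul_ne_zero (ofReal_ne_zero.mpr hkm) hz₁)
      simpa [hz₂] using this
    · have h₂ := normSq_pos.mpr hz₂
      positivity
end
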